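/- arXiv:1811.01888 — 2 statements merged into one kernel-verified Lean document; each statement's English description precedes it below -/
import Mathlib

section
/- Let k be a field, V and W finite-dimensional k-vector spaces, B : V → W → k a perfect bilinear pairing (i.e. B(v,w) = 0 for all w implies v = 0, and B(v,w) = 0 for all v implies w = 0), and φ : W → V a linear map. Assume that B(φ(u), w) = 0 for every u ∈ W and every w ∈ ker φ. Then there exists a unique bilinear form N : range φ → range φ → k satisfying N(φ(w), v) = B(v, w) for every w ∈ W and every v ∈ range φ. -/
/-- Definition 2.10 / Corollary 2.11: existence and uniqueness of the narrow pairing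
`N` on `range φ` determined by `N (φ w) v = B v w`. -/
theorem narrow_pairing_exists_unique
    (k : Type*) [Field k] (V W : Type*) [AddCommGroup V] [Module k V]
    [AddCommGroup W] [Module k W] [FiniteDimensional k V] [FiniteDimensional k W]
    (B : V →ₗ[k] W →ₗ[k] k)
    (hB₁ : ∀ v : V, (∀ w : W, B v w = 0) → v = 0)
    (hB₂ : ∀ w : W, (∀ v : V, B v w = 0) → w = 0)
    (φ : W →ₗ[k] V)
    (hvan : ∀ u : W, ∀ w ∈ LinearMap.ker φ, B (φ u) w = 0) :
    ∃! N : LinearMap.range φ →ₗ[k] LinearMap.range φ →ₗ[k] k,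
      ∀ (w : W) (v : LinearMap.range φ),
        N ⟨φ w, LinearMap.mem_range_self φ w⟩ v = B (v : V) w := by
  obtain ⟨s, hs⟩ := φ.rangeRestrict.exists_rightInverse_of_surjective φ.range_rangeRestrict
  have hφs (x : LinearMap.range φ) : φ (s x) = x :=
    congrArg Subtype.val (LinearMap.congr_fun hs x)
  refine ⟨(B.domRestrict (LinearMap.range φ)).flip ∘ₗ s, ?_, ?_⟩
  · rintro w ⟨_, u, rfl⟩
    have hker : s ⟨φ w, LinearMap.mem_range_self φ w⟩ - w ∈ LinearMap.ker φ := by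
      simp [hφs]
    have h := hvan u _ hker
    rw [map_sub, sub_eq_zero] at h
    simpa using h
  · intro N hN
    ext ⟨_, w, rfl⟩ v
    have h := hN (s ⟨φ w, LinearMap.mem_range_self φ w⟩) v
    simpa [hφs] using h
end

section
/- Let k be a field, V and W finite-dimensional k-vector spaces, B : V → W → k a perfect bilinear pairing (i.e. B(v,w) = 0 for all w implies v = 0, and B(v,w) = 0 for all v implies w = 0), and φ : W → V a linear map. Assume that B(φ(u), w) = 0 for every u ∈ W and every w ∈ ker φ, and let N : range φ → range φ → k be the bilinear form determined by N(φ(w), v) = B(v, w) for all w ∈ W and v ∈ range φ. Then N is nondegenerate: for every nonzero β ∈ range φ there exists α ∈ range φ with N(α, β) ≠ 0, and for every nonzero α ∈ range φ there exists β ∈ range φ with N(α, β) ≠ 0. -/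
/-- Proposition 2.12 (linear-algebra content): the narrow pairing `N` determined by
`N (φ w) v = B v w` is nondegenerate on `range φ`. -/
theorem narrow_pairing_nondegenerate
    (k : Type*) [Field k] (V W : Type*) [AddCommGroup V] [Module k V]
    [AddCommGroup W] [Module k W] [FiniteDimensional k V] [FiniteDimensional k W]
    (B : V →ₗ[k] W →ₗ[k] k)
    (hB₁ : ∀ v : V, (∀ w : W, B v w = 0) → v = 0)
    (hB₂ : ∀ w : W, (∀ v : V, B v w = 0) → w = 0)
    (φ : W →ₗ[k] V)
    (hvan : ∀ u : W, ∀ w ∈ LinearMap.ker φ, B (φ u) w = 0)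
    (N : LinearMap.range φ →ₗ[k] LinearMap.range φ →ₗ[k] k)
    (hN : ∀ (w : W) (v : LinearMap.range φ),
      N ⟨φ w, LinearMap.mem_range_self φ w⟩ v = B (v : V) w) :
    (∀ β : LinearMap.range φ, β ≠ 0 → ∃ α : LinearMap.range φ, N α β ≠ 0) ∧
    (∀ α : LinearMap.range φ, α ≠ 0 → ∃ β : LinearMap.range φ, N α β ≠ 0) := by
  have hright : ∀ β : LinearMap.range φ, (∀ α, N α β = 0) → β = 0 := fun β h =>
    Subtype.ext (hB₁ β fun w => by rw [← hN w β, h])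
  have hleft : ∀ α : LinearMap.range φ, (∀ β, N α β = 0) → α = 0 := by
    have hinj : Function.Injective N.flip :=
      (injective_iff_map_eq_zero _).2 fun β h => hright β fun α => by
        simpa using LinearMap.congr_fun h α
    have hsurj : Function.Surjective N.flip :=
      (LinearMap.injective_iff_surjective_of_finrank_eq_finrank
        Subspace.dual_finrank_eq.symm).1 hinj
    refine fun α h => (Module.forall_dual_apply_eq_zero_iff k α).1 fun f => ?_
    obtain ⟨β, rfl⟩ := hsurj f
    exact h β
  refine ⟨fun β hβ => ?_, fun α hα => ?_⟩
  · by_contra! h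
    exact hβ (hright β h)
  · by_contra! h
    exact hα (hleft α h)
end
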